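/- Let G be the simple graph on six vertices v1,...,v6 whose edges are the path edges v1v2, v2v3, v3v4, v4v5, v5v6 together with the chords v1v3 and v4v6 (the graph G^6_77). Then the crossing numbers of the Cartesian products G □ C_3, G □ C_4 and G □ C_5 are 6, 8 and 10 respectively. -/

import Mathlib

open SimpleGraph

/-- A drawing of a simple graph in the plane: vertices are mapped to distinct
points, and each edge is mapped to a simple arc (parametrised by `[0,1]`)
joining the images of its endpoints and avoiding the images of all vertices
in its interior. -/
structure Drawing {V : Type*} (G : SimpleGraph V) where
  vertexMap : V → ℝ × ℝ
  vertexMap_injective : Function.Injective vertexMap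
  arc : G.edgeSet → ℝ → ℝ × ℝ
  arc_continuousOn : ∀ e, ContinuousOn (arc e) (Set.Icc 0 1)
  arc_injOn : ∀ e, Set.InjOn (arc e) (Set.Icc 0 1)
  arc_endpoints : ∀ e : G.edgeSet, ∃ u v : V,
    (e : Sym2 V) = s(u, v) ∧ arc e 0 = vertexMap u ∧ arc e 1 = vertexMap v
  arc_avoids_vertices : ∀ e : G.edgeSet, ∀ t ∈ Set.Ioo (0 : ℝ) 1, ∀ w : V,
    arc e t ≠ vertexMap w

/-- The crossings of a drawing: an unordered pair of distinct edges together
with a point of the plane where the two corresponding arcs intersect away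
from their endpoints. -/
def Drawing.crossings {V : Type*} {G : SimpleGraph V} (D : Drawing G) :
    Set (Sym2 G.edgeSet × (ℝ × ℝ)) :=
  { x | ∃ e f : G.edgeSet, e ≠ f ∧ x.1 = s(e, f) ∧
      (∃ s ∈ Set.Ioo (0 : ℝ) 1, D.arc e s = x.2) ∧
      (∃ t ∈ Set.Ioo (0 : ℝ) 1, D.arc f t = x.2) }

/-- The crossing number of a simple graph: the minimum number of crossings
over all drawings of the graph in the plane. -/
noncomputable def crossingNumber {V : Type*} (G : SimpleGraph V) : ℕ :=
  sInf { n : ℕ | ∃ D : Drawing G, D.crossings.Finite ∧ D.crossings.ncard = n }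

/-- The graph `G⁶₇₇`: the path `v1 v2 v3 v4 v5 v6` together with the chords `v1v3` and `v4v6`. -/
def G6_77 : SimpleGraph (Fin 6) :=
  SimpleGraph.fromEdgeSet {s(0, 1), s(1, 2), s(2, 3), s(3, 4), s(4, 5), s(0, 2), s(3, 5)}


theorem exists_continuous_log (f : C(ℝ × ℝ, ℂ)) (hf : ∀ x, f x ≠ 0) :
    ∃ L : C(ℝ × ℝ, ℂ), ∀ x, Complex.exp (L x) = f x := by
  obtain ⟨L, ⟨-, hL⟩, -⟩ := Complex.isCoveringMapOn_exp.existsUnique_continuousMap_lifts f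
    (a₀ := (0, 0)) (e₀ := Complex.log (f (0, 0))) (Complex.exp_log (hf _)) (by simpa using hf)
  exact ⟨L, fun x => congrFun hL x⟩

/-- The increment of a continuous logarithm along a path does not depend on the logarithm,
and is invariant under scaling the path. -/
theorem log_increment_unique {L M : ℝ → ℂ} (hL : Continuous L) (hM : Continuous M) {c : ℂ}
    (h : ∀ t, Complex.exp (L t) = c * Complex.exp (M t)) : L 1 - L 0 = M 1 - M 0 := by
  have H := (Complex.isCoveringMapOn_exp.existsUnique_continuousMap_lifts
      (⟨fun t => Complex.exp (L t), by fun_prop⟩ : C(ℝ, ℂ))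
      (a₀ := 0) (e₀ := L 0) rfl (by simp)).unique
    (y₁ := ⟨L, hL⟩) (y₂ := ⟨fun t => M t + (L 0 - M 0), by fun_prop⟩) ⟨rfl, rfl⟩
    ⟨by simp, funext fun t => by
      simp [Complex.exp_add, Complex.exp_sub, h]
      field_simp⟩
  have := DFunLike.congr_fun H 1
  simp only [ContinuousMap.coe_mk] at this
  linear_combination this

/-- In any drawing of `K₃,₃` in the plane, two independent edges meet. -/
theorem exists_independent_intersection_K33 (a b : Fin 3 → ℂ) (S : Fin 3 → Fin 3 → Set ℂ)
    (hS : ∀ i j, JoinedIn (S i j) (a i) (b j)) :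
    ∃ i i' j j', i ≠ i' ∧ j ≠ j' ∧ ¬ Disjoint (S i j) (S i' j') := by
  by_contra! hdis
  choose γ' hγ' using hS
  have ⟨γ, hγc, hγ0, hγ1, hγ⟩ : ∃ γ : Fin 3 → Fin 3 → ℝ → ℂ, (∀ i j, Continuous (γ i j)) ∧
      (∀ i j, γ i j 0 = a i) ∧ (∀ i j, γ i j 1 = b j) ∧ ∀ i j t, γ i j t ∈ S i j :=
    ⟨fun i j => (γ' i j).extend, fun i j => (γ' i j).continuous_extend,
      fun i j => (γ' i j).extend_zero, fun i j => (γ' i j).extend_one, fun i j t => hγ' i j _⟩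
  have haS i j : a i ∈ S i j := hγ0 i j ▸ hγ i j 0
  have hbS i j : b j ∈ S i j := hγ1 i j ▸ hγ i j 1
  have hne {i i' j j'} (hi : i ≠ i') (hj : j ≠ j') {x y} (hx : x ∈ S i j) (hy : y ∈ S i' j') :
      x - y ≠ 0 :=
    sub_ne_zero.2 fun h => Set.disjoint_left.1 (hdis i i' j j' hi hj) hx (h ▸ hy)
  have other (j : Fin 3) : j + 1 ≠ j := by decide +revert
  choose! LA hLA using fun i' i j (h : i ≠ i') => exists_continuous_log
    ⟨fun x => γ i j x.1 - a i', by fun_prop⟩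
    fun x => hne h (other j).symm (hγ i j _) (haS i' _)
  choose! LB hLB using fun j' i j (h : j ≠ j') => exists_continuous_log
    ⟨fun x => γ i j x.1 - b j', by fun_prop⟩
    fun x => hne (other i).symm h (hγ i j _) (hbS _ j')
  simp only [ContinuousMap.coe_mk] at hLA hLB
  set DA : Fin 3 → Fin 3 → Fin 3 → ℂ := fun i' i j => LA i' i j (1, 0) - LA i' i j (0, 0) with hDA
  set DB : Fin 3 → Fin 3 → Fin 3 → ℂ := fun j' i j => LB j' i j (1, 0) - LB j' i j (0, 0) with hDB
  have sq i i' j j' (hi : i ≠ i') (hj : j ≠ j') :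
      DA i' i j + DB j i' j' = DA i i' j' + DB j' i j := by
    obtain ⟨L, hL⟩ := exists_continuous_log
      ⟨fun x => γ i j x.1 - γ i' j' x.2, by fun_prop⟩
      fun x => hne hi hj (hγ i j _) (hγ i' j' _)
    simp only [ContinuousMap.coe_mk] at hL
    have h1 : L (1, 0) - L (0, 0) = DA i' i j :=
      log_increment_unique (L := fun t => L (t, 0)) (M := fun t => LA i' i j (t, 0)) (c := 1)
        (by fun_prop) (by fun_prop) fun t => by simp [hL, hLA i' i j hi, hγ0]
    have h2 : L (1, 1) - L (0, 1) = DB j' i j :=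
      log_increment_unique (L := fun t => L (t, 1)) (M := fun t => LB j' i j (t, 0)) (c := 1)
        (by fun_prop) (by fun_prop) fun t => by simp [hL, hLB j' i j hj, hγ1]
    have h3 : L (0, 1) - L (0, 0) = DA i i' j' :=
      log_increment_unique (L := fun t => L (0, t)) (M := fun t => LA i i' j' (t, 0)) (c := -1)
        (by fun_prop) (by fun_prop) fun t => by simp [hL, hLA i i' j' hi.symm, hγ0]
    have h4 : L (1, 1) - L (1, 0) = DB j i' j' :=
      log_increment_unique (L := fun t => L (1, t)) (M := fun t => LB j i' j' (t, 0)) (c := -1)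
        (by fun_prop) (by fun_prop) fun t => by simp [hL, hLB j i' j' hj.symm, hγ1]
    rw [← h1, ← h2, ← h3, ← h4]; ring
  have eA i' i j (h : i ≠ i') : Complex.exp (DA i' i j) = (b j - a i') / (a i - a i') := by
    simp [hDA, Complex.exp_sub, hLA i' i j h, hγ0, hγ1]
  have eB j' i j (h : j ≠ j') : Complex.exp (DB j' i j) = (b j - b j') / (a i - b j') := by
    simp [hDB, Complex.exp_sub, hLB j' i j h, hγ0, hγ1]
  have haa i i' (h : i ≠ i') : a i - a i' ≠ 0 := hne h (other 0) (haS i _) (haS i' _)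
  have hbb j j' (h : j ≠ j') : b j - b j' ≠ 0 := hne (other 0) h (hbS _ j) (hbS _ j')
  have hab i j : a i - b j ≠ 0 := hne (other i).symm (other j) (haS i _) (hbS _ j)
  have flipA i i' j (h : i ≠ i') :
      Complex.exp (DA i' i j - DA i i' j) = - ((a i' - b j) / (a i - b j)) := by
    have := haa i i' h; have := haa i' i h.symm; have := hab i j; have := hab i' j
    have : b j - a i ≠ 0 := by rw [← neg_sub]; exact neg_ne_zero.2 (hab i j)
    rw [Complex.exp_sub, eA _ _ _ h, eA _ _ _ h.symm]
    field_simp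
    ring
  have flipB j j' (h : j ≠ j') :
      Complex.exp (DB j 2 j' - DB j 0 j') = (a 0 - b j) / (a 2 - b j) := by
    have := hab 0 j; have := hab 2 j; have := hbb j' j h.symm
    rw [Complex.exp_sub, eB _ _ _ h.symm, eB _ _ _ h.symm]
    field_simp
  have total : (DA 1 0 0 - DA 0 1 0) + (DA 1 0 1 - DA 0 1 1) + (DA 1 0 2 - DA 0 1 2)
      + (DA 2 0 0 - DA 0 2 0) + (DA 2 0 1 - DA 0 2 1) + (DA 2 0 2 - DA 0 2 2)
      + (DA 2 1 0 - DA 1 2 0) + (DA 2 1 1 - DA 1 2 1) + (DA 2 1 2 - DA 1 2 2)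
      + (DB 0 2 1 - DB 0 0 1) + (DB 0 2 2 - DB 0 0 2) + (DB 1 2 0 - DB 1 0 0)
      + (DB 1 2 2 - DB 1 0 2) + (DB 2 2 0 - DB 2 0 0) + (DB 2 2 1 - DB 2 0 1) = 0 := by
    have q i i' j j' (hi : i ≠ i' := by decide) (hj : j ≠ j' := by decide) := sq i i' j j' hi hj
    linear_combination (1 / 2 : ℂ) * (q 0 1 0 1 + q 0 1 0 2 + q 0 1 1 0 + q 0 1 1 2 + q 0 1 2 0
      + q 0 1 2 1 + q 0 2 0 1 + q 0 2 0 2 + q 0 2 1 0 + q 0 2 1 2 + q 0 2 2 0 + q 0 2 2 1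
      + q 1 2 0 1 + q 1 2 0 2 + q 1 2 1 0 + q 1 2 1 2 + q 1 2 2 0 + q 1 2 2 1)
  have := congrArg Complex.exp total
  simp only [Complex.exp_add _ (_ - _), Complex.exp_zero] at this
  simp only [flipA _ _ _ (show (0 : Fin 3) ≠ 1 by decide),
    flipA _ _ _ (show (0 : Fin 3) ≠ 2 by decide), flipA _ _ _ (show (1 : Fin 3) ≠ 2 by decide),
    flipB _ _ (show (0 : Fin 3) ≠ 1 by decide), flipB _ _ (show (0 : Fin 3) ≠ 2 by decide),
    flipB _ _ (show (1 : Fin 3) ≠ 0 by decide), flipB _ _ (show (1 : Fin 3) ≠ 2 by decide),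
    flipB _ _ (show (2 : Fin 3) ≠ 0 by decide), flipB _ _ (show (2 : Fin 3) ≠ 1 by decide)] at this
  have h00 := hab 0 0; have h01 := hab 0 1; have h02 := hab 0 2
  have h10 := hab 1 0; have h11 := hab 1 1; have h12 := hab 1 2
  have h20 := hab 2 0; have h21 := hab 2 1; have h22 := hab 2 2
  field_simp at this
  norm_num at this

/-! ### Drawings of `C₃ □ Cₙ` up to independent intersections -/

/-- The edges of `Cₙ □ C₃`: `(false, i, a)` joins `(i, a)` to `(i, a + 1)`, and `(true, i, a)`
joins `(i, a)` to `(i + 1, a)`. -/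
abbrev TorusEdge (n : ℕ) := Bool × Fin n × Fin 3

namespace TorusEdge

variable {n : ℕ} [NeZero n]

def tgt (e : TorusEdge n) : Fin n × Fin 3 :=
  if e.1 then (e.2.1 + 1, e.2.2) else (e.2.1, e.2.2 + 1)

/-- Two edges are independent if they share no vertex. -/
def Indep (e f : TorusEdge n) : Prop :=
  e.2 ≠ f.2 ∧ e.2 ≠ f.tgt ∧ e.tgt ≠ f.2 ∧ e.tgt ≠ f.tgt

instance (e f : TorusEdge n) : Decidable (Indep e f) := by unfold Indep; infer_instance

def rotate (c : Fin n) (e : TorusEdge n) : TorusEdge n := (e.1, e.2.1 + c, e.2.2)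

/-- The image of an edge after the edges of the last triangle have been removed and the paths
through it have been merged into single edges. -/
def removeLast (e : TorusEdge (n + 1)) : Option (TorusEdge n) :=
  if h : e.2.1.val < n then some (e.1, ⟨e.2.1, h⟩, e.2.2)
  else if e.1 then some (true, ⟨n - 1, by have := NeZero.pos n; omega⟩, e.2.2) else none

/-- The image of a pair of edges under `removeLast`. -/
def removeLastPair (p : TorusEdge (n + 1) × TorusEdge (n + 1)) :
    Option (TorusEdge n × TorusEdge n) :=
  p.1.removeLast.bind fun e => p.2.removeLast.map fun f => (e, f)

theorem removeLastPair_eq_some {p : TorusEdge (n + 1) × TorusEdge (n + 1)}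
    {q : TorusEdge n × TorusEdge n} :
    removeLastPair p = some q ↔ p.1.removeLast = some q.1 ∧ p.2.removeLast = some q.2 := by
  obtain ⟨q₁, q₂⟩ := q
  simp [removeLastPair, Option.bind_eq_some_iff]

/-- The number of ends of `p` in level `l`, for a pair `p` of edges. -/
def involvement (l : Fin n) (p : TorusEdge n × TorusEdge n) : ℕ :=
  (if p.1.2.1 = l then 1 else 0) + if p.2.2.1 = l then 1 else 0

theorem removeLast_castSucc {n : ℕ} (b : Bool) (i : Fin (n + 1)) (a : Fin 3) :
    removeLast (b, i.castSucc, a) = some (b, i, a) :=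
  dif_pos i.2

theorem removeLast_last_true {n : ℕ} (a : Fin 3) :
    removeLast (true, Fin.last (n + 1), a) = some (true, Fin.last n, a) := by
  simp [removeLast, Fin.last]

theorem removeLast_last_false {n : ℕ} (a : Fin 3) :
    removeLast (false, Fin.last (n + 1), a) = none := by
  simp [removeLast]

theorem removeLast_fst {e : TorusEdge (n + 1)} {e' : TorusEdge n} (h : e.removeLast = some e') :
    e'.1 = e.1 := by
  unfold removeLast at h
  grind

theorem removeLast_level_eq_zero {n : ℕ} {e : TorusEdge (n + 3)} {e' : TorusEdge (n + 2)}
    (h : e.removeLast = some e') (h0 : e'.2.1 = 0) : e.2.1 = 0 := by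
  obtain ⟨b, i, a⟩ := e
  induction i using Fin.lastCases with
  | last =>
    cases b
    · simp [removeLast_last_false] at h
    · rw [removeLast_last_true, Option.some.injEq] at h
      subst h
      exact absurd h0 (Fin.last_pos).ne'
  | cast i =>
    rw [removeLast_castSucc, Option.some.injEq] at h
    subst h
    exact congrArg Fin.castSucc h0

theorem removeLast_ends {n : ℕ} {e : TorusEdge (n + 2)} {e' : TorusEdge (n + 1)}
    (h : e.removeLast = some e') {v : Fin (n + 2) × Fin 3} (hv : v = e.2 ∨ v = e.tgt) :
    v = (e'.2.1.castSucc, e'.2.2) ∨ v = (e'.tgt.1.castSucc, e'.tgt.2) ∨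
      v.1 = Fin.last _ ∧ e' = (true, Fin.last _, v.2) := by
  obtain ⟨b, i, a⟩ := e
  induction i using Fin.lastCases with
  | last =>
    cases b
    · simp [removeLast_last_false] at h
    · rw [removeLast_last_true, Option.some.injEq] at h
      subst h
      rcases hv with rfl | rfl
      · exact Or.inr (Or.inr ⟨rfl, rfl⟩)
      · exact Or.inr (Or.inl (by simp [tgt]))
  | cast i =>
    rw [removeLast_castSucc, Option.some.injEq] at h
    subst h
    rcases hv with rfl | rfl
    · exact Or.inl rfl
    · cases b
      · exact Or.inr (Or.inl rfl)
      · induction i using Fin.lastCases with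
        | last => exact Or.inr (Or.inr ⟨by simp [tgt], by simp [tgt]⟩)
        | cast i => exact Or.inr (Or.inl (by simp [tgt]))

theorem Indep.of_removeLast {n : ℕ} {e f : TorusEdge (n + 2)} {e' f' : TorusEdge (n + 1)}
    (he : e.removeLast = some e') (hf : f.removeLast = some f') (h : Indep e' f') :
    Indep e f := by
  have key v (h1 : v = e.2 ∨ v = e.tgt) (h2 : v = f.2 ∨ v = f.tgt) : False := by
    have aux : ∀ x y : Fin (n + 1) × Fin 3,
        ((x.1.castSucc, x.2) : Fin (n + 2) × Fin 3) = (y.1.castSucc, y.2) → x = y := by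
      rintro ⟨x, _⟩ ⟨y, _⟩ h
      simpa using h
    obtain ⟨a1, a2, a3, a4⟩ := h
    have hlast x : Fin.castSucc x ≠ Fin.last (n + 1) := (Fin.castSucc_lt_last x).ne
    rcases removeLast_ends he h1 with r | r | ⟨r, r'⟩ <;>
      rcases removeLast_ends hf h2 with s | s | ⟨s, s'⟩
    · exact a1 (aux _ _ (r.symm.trans s))
    · exact a2 (aux _ _ (r.symm.trans s))
    · exact hlast _ ((congrArg Prod.fst r).symm.trans s)
    · exact a3 (aux _ _ (r.symm.trans s))
    · exact a4 (aux _ _ (r.symm.trans s))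
    · exact hlast _ ((congrArg Prod.fst r).symm.trans s)
    · exact hlast _ ((congrArg Prod.fst s).symm.trans r)
    · exact hlast _ ((congrArg Prod.fst s).symm.trans r)
    · exact a1 (by rw [r', s'])
  exact ⟨fun h => key _ (.inl rfl) (.inl h), fun h => key _ (.inl rfl) (.inr h),
    fun h => key _ (.inr rfl) (.inl h), fun h => key _ (.inr rfl) (.inr h)⟩

end TorusEdge

open TorusEdge

/-- Planar sets containing paths which join the ends of the edges of `Cₙ □ C₃`. -/
structure TorusDrawing (n : ℕ) [NeZero n] where
  point : Fin n × Fin 3 → ℂ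
  curve : TorusEdge n → Set ℂ
  joined : ∀ e, JoinedIn (curve e) (point e.2) (point e.tgt)

namespace TorusDrawing

/-- Every independent pair of intersecting edges occurs in the list `L`. -/
def Covers {n : ℕ} [NeZero n] (D : TorusDrawing n) (L : List (TorusEdge n × TorusEdge n)) : Prop :=
  ∀ e f, Indep e f → ¬ Disjoint (D.curve e) (D.curve f) → (e, f) ∈ L ∨ (f, e) ∈ L

def rotate {n : ℕ} (D : TorusDrawing (n + 1)) (c : Fin (n + 1)) : TorusDrawing (n + 1) where
  point v := D.point (v.1 + c, v.2)
  curve e := D.curve (e.rotate c)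
  joined e := by
    have : (e.tgt.1 + c, e.tgt.2) = (e.rotate c).tgt := by
      unfold TorusEdge.rotate tgt
      split_ifs <;> simp [add_right_comm]
    rw [this]
    exact D.joined (e.rotate c)

theorem Covers.rotate {n : ℕ} {D : TorusDrawing (n + 1)}
    {L : List (TorusEdge (n + 1) × TorusEdge (n + 1))} (h : D.Covers L) (c : Fin (n + 1)) :
    (D.rotate c).Covers (L.map (Prod.map (TorusEdge.rotate (-c)) (TorusEdge.rotate (-c)))) := by
  intro e f hef hd
  have hi : Indep (e.rotate c) (f.rotate c) := by
    unfold Indep TorusEdge.rotate tgt at *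
    split_ifs at * <;> simp_all [Prod.ext_iff, add_right_comm _ c]
  have hr (e : TorusEdge (n + 1)) : (e.rotate c).rotate (-c) = e := by simp [TorusEdge.rotate]
  refine (h _ _ hi hd).imp (fun h => ?_) (fun h => ?_) <;>
  · have := List.mem_map_of_mem (f := Prod.map (TorusEdge.rotate (-c)) (TorusEdge.rotate (-c))) h
    simpa only [Prod.map, hr] using this

/-- Removing the edges of the last triangle from a drawing of `Cₙ₊₁ □ C₃` leaves a drawing of
`Cₙ □ C₃`. -/
def removeLast {n : ℕ} (D : TorusDrawing (n + 2)) : TorusDrawing (n + 1) where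
  point v := D.point (v.1.castSucc, v.2)
  curve e' := ⋃ e ∈ {e : TorusEdge (n + 2) | e.removeLast = some e'}, D.curve e
  joined := by
    have sub {e e'} (h : e.removeLast = some e') :
        D.curve e ⊆ ⋃ e ∈ {e : TorusEdge (n + 2) | e.removeLast = some e'}, D.curve e :=
      Set.subset_biUnion_of_mem (u := D.curve) (Set.mem_ofPred.2 h)
    rintro ⟨b, i, a⟩
    have h := (D.joined (b, i.castSucc, a)).mono (sub (removeLast_castSucc b i a))
    cases b
    · simpa [tgt] using h
    · induction i using Fin.lastCases with
      | last =>
        have h' := (D.joined (true, Fin.last _, a)).mono (sub (removeLast_last_true a))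
        simp only [tgt, if_true, Fin.last_add_one] at h h' ⊢
        exact h.trans (by simpa using h')
      | cast i => simpa [tgt] using h

theorem Covers.removeLast {n : ℕ} {D : TorusDrawing (n + 2)}
    {L : List (TorusEdge (n + 2) × TorusEdge (n + 2))} (h : D.Covers L) :
    D.removeLast.Covers (L.filterMap removeLastPair) := by
  intro e' f' hi hd
  simp only [TorusDrawing.removeLast, Set.disjoint_iUnion_left, Set.disjoint_iUnion_right,
    not_forall, Set.mem_ofPred_eq] at hd
  obtain ⟨f, hf, e, he, hd⟩ := hd
  simp only [List.mem_filterMap, removeLastPair_eq_some]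
  exact (h e f (hi.of_removeLast he hf) hd).imp (fun h => ⟨_, h, he, hf⟩) fun h => ⟨_, h, hf, he⟩

end TorusDrawing

/-- `Joins l u v` says that the edges in `l` form a walk from `u` to `v`. -/
def TorusEdge.Joins {n : ℕ} [NeZero n] :
    List (TorusEdge n) → Fin n × Fin 3 → Fin n × Fin 3 → Prop
  | [], u, v => u = v
  | e :: l, u, v => e.2 = u ∧ Joins l e.tgt v ∨ e.tgt = u ∧ Joins l e.2 v

instance TorusEdge.decidableJoins {n : ℕ} [NeZero n] :
    ∀ (l : List (TorusEdge n)) (u v : Fin n × Fin 3), Decidable (Joins l u v)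
  | [], u, v => inferInstanceAs (Decidable (u = v))
  | e :: l, u, v =>
    have := decidableJoins l
    inferInstanceAs (Decidable (e.2 = u ∧ Joins l e.tgt v ∨ e.tgt = u ∧ Joins l e.2 v))

theorem TorusDrawing.joinedIn_of_joins {n : ℕ} [NeZero n] (D : TorusDrawing n)
    (l : List (TorusEdge n)) (u v : Fin n × Fin 3) (hl : l ≠ []) (h : Joins l u v) :
    JoinedIn (⋃ e ∈ l, D.curve e) (D.point u) (D.point v) := by
  induction l generalizing u with
  | nil => exact absurd rfl hl
  | cons e l ih =>
    have he : JoinedIn (⋃ e' ∈ e :: l, D.curve e') (D.point e.2) (D.point e.tgt) :=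
      (D.joined e).mono
        (Set.subset_biUnion_of_mem (u := D.curve) (by simp : e ∈ {e' | e' ∈ e :: l}))
    have step w (hw : w = e.2 ∨ w = e.tgt) (h : Joins l w v) :
        JoinedIn (⋃ e' ∈ e :: l, D.curve e') (D.point w) (D.point v) := by
      by_cases h0 : l = []
      · subst h0
        obtain rfl : w = v := h
        rcases hw with rfl | rfl
        · exact .refl he.source_mem
        · exact .refl he.target_mem
      · exact (ih w h0 h).mono
          (Set.biUnion_subset_biUnion_left fun x hx => List.mem_cons_of_mem _ hx)
    rcases h with ⟨rfl, h⟩ | ⟨rfl, h⟩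
    · exact he.trans (step _ (.inr rfl) h)
    · exact he.symm.trans (step _ (.inl rfl) h)

/-- Nine walks in `C₃ □ C₃` between three vertices `a i` and three vertices `b j`. -/
structure WalkSystem where
  a : Fin 3 → Fin 3 × Fin 3
  b : Fin 3 → Fin 3 × Fin 3
  walk : Fin 3 → Fin 3 → List (TorusEdge 3)

namespace WalkSystem

/-- The walks of the system form a subdivision of `K₃,₃`, as far as independent edges are
concerned. -/
def IsSubdivision (K : WalkSystem) : Prop :=
  (∀ i j, K.walk i j ≠ [] ∧ Joins (K.walk i j) (K.a i) (K.b j)) ∧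
  ∀ i j, ∀ e ∈ K.walk i j, ∀ i', i ≠ i' → ∀ j', j ≠ j' → ∀ f ∈ K.walk i' j', Indep e f

instance (K : WalkSystem) :
    Decidable (∀ i j, K.walk i j ≠ [] ∧ Joins (K.walk i j) (K.a i) (K.b j)) := inferInstance

instance (K : WalkSystem) :
    Decidable (∀ i j, ∀ e ∈ K.walk i j, ∀ i', i ≠ i' → ∀ j', j ≠ j' →
      ∀ f ∈ K.walk i' j', Indep e f) := inferInstance

instance (K : WalkSystem) : Decidable K.IsSubdivision := by unfold IsSubdivision; infer_instance

/-- A test whether the pair `p` of edges belongs to independent walks of the system. -/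
def hits (K : WalkSystem) (p : TorusEdge 3 × TorusEdge 3) : Bool :=
  (List.finRange 3).any fun i => (List.finRange 3).any fun j => decide (p.1 ∈ K.walk i j) &&
    (List.finRange 3).any fun i' => (List.finRange 3).any fun j' =>
      i != i' && j != j' && decide (p.2 ∈ K.walk i' j')

theorem hits_iff {K : WalkSystem} {p : TorusEdge 3 × TorusEdge 3} : K.hits p ↔
    ∃ i j, p.1 ∈ K.walk i j ∧ ∃ i' j', i ≠ i' ∧ j ≠ j' ∧ p.2 ∈ K.walk i' j' := by
  simp [hits, and_assoc]

theorem IsSubdivision.exists_hits {K : WalkSystem} (hK : K.IsSubdivision) {D : TorusDrawing 3}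
    {L : List (TorusEdge 3 × TorusEdge 3)} (hL : D.Covers L) : ∃ p ∈ L, K.hits p := by
  obtain ⟨i, i', j, j', hi, hj, hd⟩ := exists_independent_intersection_K33
    (fun i => D.point (K.a i)) (fun j => D.point (K.b j)) (fun i j => ⋃ e ∈ K.walk i j, D.curve e)
    fun i j => D.joinedIn_of_joins _ _ _ (hK.1 i j).1 (hK.1 i j).2
  simp only [Set.disjoint_iUnion_left, Set.disjoint_iUnion_right, not_forall] at hd
  obtain ⟨f, hf, e, he, hd⟩ := hd
  rcases hL e f (hK.2 i j e he i' hi j' hj f hf) hd with h | h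
  · exact ⟨_, h, hits_iff.2 ⟨i, j, he, i', j', hi, hj, hf⟩⟩
  · exact ⟨_, h, hits_iff.2 ⟨i', j', hf, i, j, hi.symm, hj.symm, he⟩⟩

/-- Seven subdivisions of `K₃,₃` in `C₃ □ C₃`. -/
def table : Fin 7 → WalkSystem :=
  ![⟨![(0, 2), (1, 1), (2, 0)], ![(1, 0), (2, 1), (2, 2)],
      ![![[(false, 0, 2), (true, 0, 0)], [(false, 0, 1), (true, 2, 1)], [(true, 2, 2)]],
        ![[(false, 1, 0)], [(true, 1, 1)], [(false, 1, 1), (true, 1, 2)]],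
        ![[(true, 1, 0)], [(false, 2, 0)], [(false, 2, 2)]]]⟩,
    ⟨![(0, 0), (1, 1), (2, 2)], ![(0, 2), (1, 2), (2, 1)],
      ![![[(false, 0, 2)], [(true, 0, 0), (false, 1, 2)], [(true, 2, 0), (false, 2, 0)]],
        ![[(true, 0, 1), (false, 0, 1)], [(false, 1, 1)], [(true, 1, 1)]],
        ![[(true, 2, 2)], [(true, 1, 2)], [(false, 2, 1)]]]⟩,
    ⟨![(0, 0), (0, 2), (2, 1)], ![(0, 1), (1, 1), (2, 2)],
      ![![[(false, 0, 0)], [(true, 0, 0), (false, 1, 0)], [(true, 2, 0), (false, 2, 2)]],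
        ![[(false, 0, 1)], [(true, 0, 2), (false, 1, 1)], [(true, 2, 2)]],
        ![[(true, 2, 1)], [(true, 1, 1)], [(false, 2, 1)]]]⟩,
    ⟨![(0, 2), (1, 0), (2, 2)], ![(1, 2), (2, 0), (2, 1)],
      ![![[(true, 0, 2)], [(false, 0, 2), (true, 2, 0)], [(false, 0, 1), (true, 2, 1)]],
        ![[(false, 1, 2)], [(true, 1, 0)], [(false, 1, 0), (true, 1, 1)]],
        ![[(true, 1, 2)], [(false, 2, 2)], [(false, 2, 1)]]]⟩,
    ⟨![(0, 0), (0, 2), (1, 1)], ![(0, 1), (1, 2), (2, 0)],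
      ![![[(false, 0, 0)], [(true, 0, 0), (false, 1, 2)], [(true, 2, 0)]],
        ![[(false, 0, 1)], [(true, 0, 2)], [(true, 2, 2), (false, 2, 2)]],
        ![[(true, 0, 1)], [(false, 1, 1)], [(true, 1, 1), (false, 2, 0)]]]⟩,
    ⟨![(0, 0), (1, 1), (2, 0)], ![(0, 1), (1, 0), (1, 2)],
      ![![[(false, 0, 0)], [(true, 0, 0)], [(false, 0, 2), (true, 0, 2)]],
        ![[(true, 0, 1)], [(false, 1, 0)], [(false, 1, 1)]],
        ![[(false, 2, 0), (true, 2, 1)], [(true, 1, 0)], [(false, 2, 2), (true, 1, 2)]]]⟩,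
    ⟨![(0, 0), (1, 0), (2, 1)], ![(0, 1), (2, 0), (2, 2)],
      ![![[(false, 0, 0)], [(true, 2, 0)], [(false, 0, 2), (true, 2, 2)]],
        ![[(false, 1, 0), (true, 0, 1)], [(true, 1, 0)], [(false, 1, 2), (true, 1, 2)]],
        ![[(true, 2, 1)], [(false, 2, 0)], [(false, 2, 1)]]]⟩]

theorem table_isSubdivision (k : Fin 7) : (table k).IsSubdivision := by
  decide +kernel +revert

theorem card_filter_table_hits (p : TorusEdge 3 × TorusEdge 3) :
    (Finset.univ.filter fun k => (table k).hits p).card ≤ 3 := by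
  decide +kernel +revert

theorem exists_table_not_hits (i : Fin 3) (q : Fin 3 × Fin 3) (hq : q.1 ≠ 0) :
    ∃ k, ¬ (table k).hits ((true, 0, i), (true, q)) ∧ ¬ (table k).hits ((true, q), (true, 0, i)) ∧
      ∀ q₁ q₂ : Fin 3 × Fin 3, q₁.1 ≠ 0 → q₂.1 ≠ 0 → ¬ (table k).hits ((true, q₁), (true, q₂)) := by
  decide +kernel +revert

end WalkSystem

namespace TorusDrawing

open WalkSystem

theorem three_le_length_of_covers {D : TorusDrawing 3} {L : List (TorusEdge 3 × TorusEdge 3)}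
    (hL : D.Covers L) : 3 ≤ L.length := by
  have h := Finset.card_biUnion_le_card_mul L.toFinset
    (fun p => Finset.univ.filter fun k => (table k).hits p) 3 fun p _ => card_filter_table_hits p
  have hu : (L.toFinset.biUnion fun p => Finset.univ.filter fun k => (table k).hits p)
      = Finset.univ := by
    ext k
    simpa using (table_isSubdivision k).exists_hits hL
  rw [hu, Finset.card_univ, Fintype.card_fin] at h
  have := L.toFinset_card_le
  omega

theorem _root_.TorusEdge.sum_involvement_filterMap_le {n : ℕ}
    (L : List (TorusEdge (n + 3) × TorusEdge (n + 3))) :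
    ((L.filterMap removeLastPair).map (involvement 0)).sum ≤ (L.map (involvement 0)).sum := by
  induction L with
  | nil => simp
  | cons p L ih =>
    cases hp : removeLastPair p with
    | none => simp [hp]; omega
    | some q =>
      rw [removeLastPair_eq_some] at hp
      have h1 := removeLast_level_eq_zero hp.1
      have h2 := removeLast_level_eq_zero hp.2
      have : involvement 0 q ≤ involvement 0 p := by
        unfold involvement
        split_ifs <;> simp_all
      rw [← removeLastPair_eq_some] at hp
      simp [hp]
      omega

/-- If only edges between different triangles cross, then every level is involved in crossings
at least twice. -/
theorem two_le_sum_involvement {n : ℕ} (D : TorusDrawing (n + 3))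
    (L : List (TorusEdge (n + 3) × TorusEdge (n + 3))) (hL : D.Covers L)
    (hs : ∀ p ∈ L, p.1.1 = true ∧ p.2.1 = true) : 2 ≤ (L.map (involvement 0)).sum := by
  induction n with
  | zero =>
    by_contra! hlt
    obtain ⟨i, q, hq, hp⟩ : ∃ (i : Fin 3) (q : Fin 3 × Fin 3), q.1 ≠ 0 ∧
        ∀ p ∈ L, (p.1.2.1 ≠ 0 ∧ p.2.2.1 ≠ 0) ∨ p = ((true, 0, i), (true, q)) ∨
          p = ((true, q), (true, 0, i)) := by
      by_cases h0 : ∀ p ∈ L, involvement 0 p = 0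
      · refine ⟨0, (1, 0), by decide, fun p hp => Or.inl ?_⟩
        have := h0 p hp
        unfold involvement at this
        split_ifs at this <;> simp_all
      · push Not at h0
        obtain ⟨p, hp, hp0⟩ := h0
        obtain ⟨s, t, rfl⟩ := List.append_of_mem hp
        simp only [List.map_append, List.map_cons, List.sum_append, List.sum_cons] at hlt
        have hz : ∀ r, r ∈ s ∨ r ∈ t → r.1.2.1 ≠ 0 ∧ r.2.2.1 ≠ 0 := by
          intro r hr
          have : involvement 0 r = 0 := by
            rcases hr with hr | hr
            · have := List.le_sum_of_mem (List.mem_map_of_mem (f := involvement 0) hr)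
              omega
            · have := List.le_sum_of_mem (List.mem_map_of_mem (f := involvement 0) hr)
              omega
          unfold involvement at this
          split_ifs at this <;> simp_all
        have h1 : involvement 0 p = 1 := by omega
        obtain ⟨hs1, hs2⟩ := hs p hp
        obtain ⟨⟨b, j, a⟩, ⟨b', j', a'⟩⟩ := p
        simp only at hs1 hs2
        subst hs1 hs2
        have hcase : j = 0 ∧ j' ≠ 0 ∨ j' = 0 ∧ j ≠ 0 := by
          unfold involvement at h1
          split_ifs at h1 <;> simp_all
        rcases hcase with ⟨rfl, hj⟩ | ⟨rfl, hj⟩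
        · refine ⟨a, (j', a'), hj, fun r hr => ?_⟩
          grind
        · refine ⟨a', (j, a), hj, fun r hr => ?_⟩
          grind
    obtain ⟨k, hk1, hk2, hk3⟩ := exists_table_not_hits i q hq
    obtain ⟨p, hpL, hK⟩ := (table_isSubdivision k).exists_hits hL
    obtain ⟨hs1, hs2⟩ := hs p hpL
    rcases hp p hpL with ⟨h1, h2⟩ | rfl | rfl
    · obtain ⟨⟨b, r⟩, ⟨b', r'⟩⟩ := p
      simp only at hs1 hs2
      subst hs1 hs2
      exact hk3 r r' h1 h2 hK
    · exact hk1 hK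
    · exact hk2 hK
  | succ n ih =>
    refine (ih D.removeLast _ hL.removeLast fun q hq => ?_).trans (sum_involvement_filterMap_le L)
    obtain ⟨p, hp, hpq⟩ := List.mem_filterMap.1 hq
    rw [removeLastPair_eq_some] at hpq
    rw [removeLast_fst hpq.1, removeLast_fst hpq.2]
    exact hs p hp

theorem _root_.TorusEdge.sum_sum_involvement {n : ℕ} [NeZero n]
    (L : List (TorusEdge n × TorusEdge n)) :
    ∑ l, (L.map (involvement l)).sum = 2 * L.length := by
  induction L with
  | nil => simp
  | cons p L ih =>
    simp only [List.map_cons, List.sum_cons, Finset.sum_add_distrib, ih, List.length_cons]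
    simp [involvement, Finset.sum_add_distrib]
    ring

/-- The crossing number of `Cₙ □ C₃` is at least `n`, in terms of independent crossings. -/
theorem le_length_of_covers {n : ℕ} (D : TorusDrawing (n + 3))
    (L : List (TorusEdge (n + 3) × TorusEdge (n + 3))) (hL : D.Covers L) : n + 3 ≤ L.length := by
  induction n with
  | zero => exact three_le_length_of_covers hL
  | succ n ih =>
    by_cases hs : ∀ p ∈ L, p.1.1 = true ∧ p.2.1 = true
    · by_contra! hlt
      have hsum := sum_sum_involvement L
      have h2 : ∑ _l : Fin (n + 1 + 3), 2 ≤ ∑ l, (L.map (involvement l)).sum := by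
        refine Finset.sum_le_sum fun l _ => ?_
        refine (two_le_sum_involvement (D.rotate l) _ (hL.rotate l) ?_).trans_eq ?_
        · intro q hq
          obtain ⟨p, hp, rfl⟩ := List.mem_map.1 hq
          exact hs p hp
        · rw [List.map_map]
          congr 2
          funext p
          simp [involvement, TorusEdge.rotate, ← sub_eq_add_neg, sub_eq_zero]
      simp at h2
      omega
    · obtain ⟨p, hp, l, hpl⟩ : ∃ p ∈ L, ∃ l, p.1.1 = false ∧ p.1.2.1 = l ∨
          p.2.1 = false ∧ p.2.2.1 = l := by
        push Not at hs
        obtain ⟨p, hp, h⟩ := hs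
        refine ⟨p, hp, ?_⟩
        by_cases h1 : p.1.1 = true
        · exact ⟨_, .inr ⟨by simpa using h h1, rfl⟩⟩
        · exact ⟨_, .inl ⟨by simpa using h1, rfl⟩⟩
      have := ih _ _ (hL.rotate (l - Fin.last _)).removeLast
      refine this.trans_lt ?_
      rw [← L.length_map (f := Prod.map (TorusEdge.rotate (-(l - Fin.last _)))
        (TorusEdge.rotate (-(l - Fin.last _)))), List.length_filterMap_lt_length_iff_exists]
      refine ⟨_, List.mem_map_of_mem hp, ?_⟩
      rcases hpl with ⟨h, rfl⟩ | ⟨h, rfl⟩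
      · have : (p.1.rotate (-(p.1.2.1 - Fin.last _))).removeLast = none := by
          rw [TorusEdge.rotate, h]
          simpa using removeLast_last_false (n := n + 2) p.1.2.2
        rw [removeLastPair, Prod.map_fst, this, Option.bind_none]
      · have (x : TorusEdge (n + 1 + 3)) (y : Option (TorusEdge (n + 3))) (hy : y = none) :
            x.removeLast.bind (fun e => y.map fun f => (e, f)) = none := by simp [hy]
        refine this _ _ ?_
        rw [Prod.map_snd, TorusEdge.rotate, h]
        simpa using removeLast_last_false (n := n + 2) p.2.2.2

end TorusDrawing

/-! ### Straight-line drawings -/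

/-- Twice the signed area of the triangle `p q r`. -/
def signedArea (p q r : ℝ × ℝ) : ℝ :=
  (q.1 - p.1) * (r.2 - p.2) - (q.2 - p.2) * (r.1 - p.1)

/-- The positive terms of twice the signed area of the triangle `p q r`. -/
def posArea (p q r : ℕ × ℕ) : ℕ := q.1 * r.2 + p.1 * q.2 + r.1 * p.2

/-- The negative terms of twice the signed area of the triangle `p q r`. -/
def negArea (p q r : ℕ × ℕ) : ℕ := q.2 * r.1 + p.2 * q.1 + r.2 * p.1

/-- The open segment `r s` lies strictly on one side of the line `p q`. -/
def oneSide (p q r s : ℕ × ℕ) : Bool :=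
  Nat.ble (posArea p q r) (negArea p q r) && Nat.ble (posArea p q s) (negArea p q s) &&
    Nat.blt (posArea p q r + posArea p q s) (negArea p q r + negArea p q s) ||
  Nat.ble (negArea p q r) (posArea p q r) && Nat.ble (negArea p q s) (posArea p q s) &&
    Nat.blt (negArea p q r + negArea p q s) (posArea p q r + posArea p q s)

def natPoint (p : ℕ × ℕ) : ℝ × ℝ := (p.1, p.2)

theorem natPoint_injective : Function.Injective natPoint := fun p q h => by
  simpa [natPoint, Prod.ext_iff] using h

theorem signedArea_natPoint (p q r : ℕ × ℕ) :
    signedArea (natPoint p) (natPoint q) (natPoint r) = posArea p q r - negArea p q r := by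
  simp only [signedArea, natPoint, posArea, negArea]
  push_cast
  ring

theorem signedArea_lineMap_self (p q : ℝ × ℝ) (t : ℝ) :
    signedArea p q (AffineMap.lineMap p q t) = 0 := by
  simp [signedArea, AffineMap.lineMap_apply]
  ring

theorem signedArea_lineMap (p q r s : ℝ × ℝ) (t : ℝ) :
    signedArea p q (AffineMap.lineMap r s t) =
      (1 - t) * signedArea p q r + t * signedArea p q s := by
  simp [signedArea, AffineMap.lineMap_apply]
  ring

theorem lineMap_ne_of_oneSide {p q r s : ℕ × ℕ} (h : oneSide p q r s) (u : ℝ) {t : ℝ}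
    (ht : t ∈ Set.Ioo (0 : ℝ) 1) :
    AffineMap.lineMap (natPoint p) (natPoint q) u ≠
      AffineMap.lineMap (natPoint r) (natPoint s) t := by
  intro heq
  have h0 := signedArea_lineMap_self (natPoint p) (natPoint q) u
  rw [heq, signedArea_lineMap, signedArea_natPoint, signedArea_natPoint] at h0
  obtain ⟨ht0, ht1⟩ := ht
  have h1t : 0 < 1 - t := by linarith
  simp only [oneSide, Bool.or_eq_true, Bool.and_eq_true, Nat.ble_eq, Nat.blt_eq] at h
  rify at h
  rcases h with ⟨⟨hr, hs⟩, h⟩ | ⟨⟨hr, hs⟩, h⟩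
  · have h1 := mul_nonneg h1t.le (sub_nonneg.2 hr)
    have h2 := mul_nonneg ht0.le (sub_nonneg.2 hs)
    have h3 := (mul_eq_zero.1 (by linarith : (1 - t) * ((negArea p q r : ℝ) - posArea p q r) = 0))
    have h4 := (mul_eq_zero.1 (by linarith : t * ((negArea p q s : ℝ) - posArea p q s) = 0))
    have h3 := h3.resolve_left h1t.ne'
    have h4 := h4.resolve_left ht0.ne'
    linarith
  · have h1 := mul_nonneg h1t.le (sub_nonneg.2 hr)
    have h2 := mul_nonneg ht0.le (sub_nonneg.2 hs)
    have h3 := (mul_eq_zero.1 (by linarith : (1 - t) * ((posArea p q r : ℝ) - negArea p q r) = 0))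
    have h4 := (mul_eq_zero.1 (by linarith : t * ((posArea p q s : ℝ) - negArea p q s) = 0))
    have h3 := h3.resolve_left h1t.ne'
    have h4 := h4.resolve_left ht0.ne'
    linarith

/-- A test for the injectivity of `pos`. -/
def checkInjective {V : Type*} [DecidableEq V] (vertices : List V) (pos : V → ℕ × ℕ) : Bool :=
  vertices.all fun v => vertices.all fun w =>
    (pos v).1 != (pos w).1 || (pos v).2 != (pos w).2 || decide (v = w)

/-- A test whether straight edges avoid all vertices except their ends. -/
def checkVertices {V : Type*} [DecidableEq V] (vertices : List V) (pos : V → ℕ × ℕ)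
    (edges : List (V × V)) : Bool :=
  edges.all fun p => vertices.all fun w =>
    posArea (pos p.1) (pos p.2) (pos w) != negArea (pos p.1) (pos p.2) (pos w) ||
      decide (w = p.1) || decide (w = p.2)

/-- A test whether straight edges are disjoint unless they form a pair in `C`. -/
def checkEdges {V : Type*} [DecidableEq V] (pos : V → ℕ × ℕ) (edges : List (V × V))
    (C : List ((V × V) × (V × V))) : Bool :=
  edges.all fun p => edges.all fun q =>
    oneSide (pos p.1) (pos p.2) (pos q.1) (pos q.2) ||
      oneSide (pos q.1) (pos q.2) (pos p.1) (pos p.2) ||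
      decide (p = q) || decide ((p, q) ∈ C) || decide ((q, p) ∈ C)

/-- A test whether the edges of the pairs in `C` are not parallel. -/
def checkCrossings {V : Type*} (pos : V → ℕ × ℕ) (C : List ((V × V) × (V × V))) : Bool :=
  C.all fun c =>
    posArea (pos c.1.1) (pos c.1.2) (pos c.2.1) + negArea (pos c.1.1) (pos c.1.2) (pos c.2.2) !=
      posArea (pos c.1.1) (pos c.1.2) (pos c.2.2) + negArea (pos c.1.1) (pos c.1.2) (pos c.2.1)

/-- A straight-line drawing on integer points, with crossings only between the pairs of edges
listed in `C`. -/
theorem exists_drawing_straightLine {V : Type*} [DecidableEq V] {G : SimpleGraph V}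
    (vertices : List V) (hV : ∀ v, v ∈ vertices) (edges : List (V × V))
    (hE : ∀ u v, G.Adj u v → (u, v) ∈ edges ∨ (v, u) ∈ edges)
    (C : List ((V × V) × (V × V))) (pos : V → ℕ × ℕ)
    (hpos : checkInjective vertices pos) (havoid : checkVertices vertices pos edges)
    (hcross : checkEdges pos edges C) (hC : checkCrossings pos C) :
    ∃ D : Drawing G, D.crossings.Finite ∧ D.crossings.ncard ≤ C.length := by
  replace hpos : Function.Injective pos := fun v w h => by
    simpa [h] using List.all_eq_true.1 (List.all_eq_true.1 hpos v (hV v)) w (hV w)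
  replace havoid : ∀ p ∈ edges, ∀ w, posArea (pos p.1) (pos p.2) (pos w) ≠
      negArea (pos p.1) (pos p.2) (pos w) ∨ w = p.1 ∨ w = p.2 := fun p hp w => by
    simpa [or_assoc] using List.all_eq_true.1 (List.all_eq_true.1 havoid p hp) w (hV w)
  simp only [checkEdges, List.all_eq_true, Bool.or_eq_true, decide_eq_true_eq, or_assoc] at hcross
  simp only [checkCrossings, List.all_eq_true, bne_iff_ne] at hC
  have hex : ∀ e : G.edgeSet, ∃ p ∈ edges, (e : Sym2 V) = s(p.1, p.2) := by
    rintro ⟨e, he⟩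
    induction e using Sym2.ind with
    | _ u v =>
      rcases hE u v he with h | h
      · exact ⟨_, h, rfl⟩
      · exact ⟨_, h, Sym2.eq_swap⟩
  choose P hP heP using hex
  have hne (e : G.edgeSet) : natPoint (pos (P e).1) ≠ natPoint (pos (P e).2) := fun h => by
    have hadj : s((P e).1, (P e).2) ∈ G.edgeSet := heP e ▸ e.2
    exact G.ne_of_adj hadj (hpos (natPoint_injective h))
  have hinj (e : G.edgeSet) : Function.Injective
      (AffineMap.lineMap (natPoint (pos (P e).1)) (natPoint (pos (P e).2)) : ℝ → ℝ × ℝ) :=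
    AffineMap.lineMap_injective ℝ (hne e)
  let D : Drawing G :=
    { vertexMap := fun v => natPoint (pos v)
      vertexMap_injective := natPoint_injective.comp hpos
      arc := fun e => AffineMap.lineMap (natPoint (pos (P e).1)) (natPoint (pos (P e).2))
      arc_continuousOn := fun e => AffineMap.lineMap_continuous.continuousOn
      arc_injOn := fun e => (hinj e).injOn
      arc_endpoints := fun e => ⟨_, _, heP e, by simp, by simp⟩
      arc_avoids_vertices := fun e t ht w h => by
        rcases havoid _ (hP e) w with h' | rfl | rfl
        · have := signedArea_lineMap_self (natPoint (pos (P e).1)) (natPoint (pos (P e).2)) t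
          rw [h, signedArea_natPoint, sub_eq_zero] at this
          exact h' (by exact_mod_cast this)
        · exact ht.1.ne' (hinj e (by simpa using h))
        · exact ht.2.ne (hinj e (by simpa using h)) }
  have hcr : ∀ x ∈ D.crossings, ∃ e f : G.edgeSet, (P e, P f) ∈ C ∧ x.1 = s(e, f) ∧
      (∃ s, D.arc e s = x.2) ∧ ∃ t, D.arc f t = x.2 := by
    rintro x ⟨e, f, hef, hx, ⟨s, hs, hs'⟩, ⟨t, ht, ht'⟩⟩
    rcases hcross _ (hP e) _ (hP f) with h | h | h | h | h
    · exact absurd (hs'.trans ht'.symm) (lineMap_ne_of_oneSide h s ht)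
    · exact absurd (ht'.trans hs'.symm) (lineMap_ne_of_oneSide h t hs)
    · exact absurd (Subtype.ext ((heP e).trans (h ▸ (heP f).symm))) hef
    · exact ⟨e, f, h, hx, ⟨s, hs'⟩, ⟨t, ht'⟩⟩
    · exact ⟨f, e, h, hx.trans Sym2.eq_swap, ⟨t, ht'⟩, ⟨s, hs'⟩⟩
  have huniq (e f : G.edgeSet) (h : (P e, P f) ∈ C) {s t s' t' : ℝ} (h1 : D.arc e s = D.arc f t)
      (h2 : D.arc e s' = D.arc f t') : t = t' := by
    have h0 := signedArea_lineMap_self (natPoint (pos (P e).1)) (natPoint (pos (P e).2)) s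
    have h0' := signedArea_lineMap_self (natPoint (pos (P e).1)) (natPoint (pos (P e).2)) s'
    rw [show AffineMap.lineMap _ _ s = _ from h1] at h0
    rw [show AffineMap.lineMap _ _ s' = _ from h2] at h0'
    simp only [D, signedArea_lineMap, signedArea_natPoint] at h0 h0'
    have hc := hC _ h
    rify at hc
    refine sub_eq_zero.1 ((mul_eq_zero.1 ?_).resolve_right (sub_ne_zero.2 hc))
    linear_combination h0' - h0
  have hinjOn : Set.InjOn (fun x : Sym2 G.edgeSet × (ℝ × ℝ) => x.1.map Subtype.val)
      D.crossings := by
    intro x hx y hy hxy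
    have hxy' : x.1 = y.1 := Sym2.map.injective Subtype.val_injective hxy
    obtain ⟨e, f, hc, hx1, ⟨s, hs⟩, ⟨t, ht⟩⟩ := hcr x hx
    obtain ⟨e', f', -, hy1, ⟨s', hs'⟩, ⟨t', ht'⟩⟩ := hcr y hy
    refine Prod.ext hxy' ?_
    rw [hx1, hy1, Sym2.eq_iff] at hxy'
    rcases hxy' with ⟨rfl, rfl⟩ | ⟨rfl, rfl⟩
    · rw [← ht, ← ht', huniq e f hc (hs.trans ht.symm) (hs'.trans ht'.symm)]
    · rw [← ht, ← hs', huniq e f hc (hs.trans ht.symm) (ht'.trans hs'.symm)]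
  set F : Finset (Sym2 (Sym2 V)) :=
    (C.map fun c => s(s(c.1.1, c.1.2), s(c.2.1, c.2.2))).toFinset with hF
  have hmaps : ∀ x ∈ D.crossings, x.1.map Subtype.val ∈ (F : Set (Sym2 (Sym2 V))) := by
    intro x hx
    obtain ⟨e, f, hc, hx1, -, -⟩ := hcr x hx
    rw [hx1, Sym2.map_mk, heP e, heP f, hF, Finset.mem_coe, List.mem_toFinset]
    exact List.mem_map_of_mem
      (f := fun c : (V × V) × (V × V) => s(s(c.1.1, c.1.2), s(c.2.1, c.2.2))) hc
  refine ⟨D, F.finite_toSet.of_injOn hmaps hinjOn, ?_⟩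
  refine (Set.ncard_le_ncard_of_injOn _ hmaps hinjOn F.finite_toSet).trans ?_
  rw [Set.ncard_coe_finset]
  exact (List.toFinset_card_le _).trans (by simp)

/-! ### Drawings of `G6_77 □ Cₙ` -/

theorem G6_77_adj {a b : Fin 6} : G6_77.Adj a b ↔ s(a, b) ∈
    [s(0, 1), s(1, 2), s(2, 3), s(3, 4), s(4, 5), s(0, 2), s((3 : Fin 6), 5)] := by
  simp only [G6_77, SimpleGraph.fromEdgeSet_adj]
  decide +revert

instance : DecidableRel G6_77.Adj := fun _ _ => decidable_of_iff _ G6_77_adj.symm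

/-- The vertices `(r, k)`, `k : Fin n`, lie on the polygon obtained from the polygon `d` by the
similarity `z ↦ (a r + b r * I) * z`, followed by a translation. -/
def nestedPolygons {n : ℕ} (d : Fin n → ℤ × ℤ) (v : Fin 6 × Fin n) : ℕ × ℕ :=
  let a : Fin 6 → ℤ := ![6, 10, 17, 25, 29, 38]
  let b : Fin 6 → ℤ := ![0, -3, -2, -2, -1, 4]
  ((a v.1 * (d v.2).1 - b v.1 * (d v.2).2 + 250).toNat,
    (a v.1 * (d v.2).2 + b v.1 * (d v.2).1 + 250).toNat)

def vertexList (n : ℕ) : List (Fin 6 × Fin n) :=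
  List.finRange 6 ×ˢ List.finRange n

theorem mem_vertexList {n : ℕ} (v : Fin 6 × Fin n) : v ∈ vertexList n :=
  List.mem_product.2 ⟨List.mem_finRange _, List.mem_finRange _⟩

def edgeList (n : ℕ) [NeZero n] : List ((Fin 6 × Fin n) × (Fin 6 × Fin n)) :=
  (List.finRange n).flatMap fun k =>
    ([(0, 1), (1, 2), (2, 3), (3, 4), (4, 5), (0, 2), (3, 5)].map fun e : Fin 6 × Fin 6 =>
      ((e.1, k), (e.2, k))) ++
    (List.finRange 6).map fun r => ((r, k), (r, k + 1))

/-- The edges `(0, k) (2, k)` and `(3, k) (5, k)` cross the polygon in between. -/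
def crossingList (n : ℕ) [NeZero n] :
    List (((Fin 6 × Fin n) × (Fin 6 × Fin n)) × ((Fin 6 × Fin n) × (Fin 6 × Fin n))) :=
  (List.finRange n).flatMap fun k =>
    [(((0, k), (2, k)), ((1, k), (1, k + 1))), (((3, k), (5, k)), ((4, k), (4, k + 1)))]

theorem mem_edgeList_of_adj {n : ℕ} (u v : Fin 6 × Fin (n + 2))
    (h : (G6_77 □ SimpleGraph.cycleGraph (n + 2)).Adj u v) :
    (u, v) ∈ edgeList (n + 2) ∨ (v, u) ∈ edgeList (n + 2) := by
  obtain ⟨a, i⟩ := u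
  obtain ⟨b, j⟩ := v
  have hG : G6_77.Adj a b → (a, b) ∈ [(0, 1), (1, 2), (2, 3), (3, 4), (4, 5), (0, 2), (3, 5)] ∨
      (b, a) ∈ [(0, 1), (1, 2), (2, 3), (3, 4), (4, 5), (0, 2), ((3 : Fin 6), (5 : Fin 6))] := by
    clear h
    decide +revert
  rw [SimpleGraph.boxProd_adj, SimpleGraph.cycleGraph_adj] at h
  rcases h with ⟨h, rfl⟩ | ⟨h | h, rfl⟩
  · refine (hG h).imp (fun h => ?_) fun h => ?_ <;>
    · refine List.mem_flatMap.2 ⟨i, List.mem_finRange i, List.mem_append_left _ ?_⟩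
      exact List.mem_map_of_mem (f := fun e : Fin 6 × Fin 6 => ((e.1, i), (e.2, i))) h
  · refine .inr (List.mem_flatMap.2 ⟨j, List.mem_finRange j, List.mem_append_right _ ?_⟩)
    rw [List.mem_map]
    exact ⟨a, List.mem_finRange a, by rw [← sub_eq_iff_eq_add'.1 h]⟩
  · refine .inl (List.mem_flatMap.2 ⟨i, List.mem_finRange i, List.mem_append_right _ ?_⟩)
    rw [List.mem_map]
    exact ⟨a, List.mem_finRange a, by rw [← sub_eq_iff_eq_add'.1 h]⟩

theorem exists_drawing_three : ∃ D : Drawing (G6_77 □ SimpleGraph.cycleGraph 3),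
    D.crossings.Finite ∧ D.crossings.ncard ≤ 6 :=
  exists_drawing_straightLine (vertexList 3) mem_vertexList (edgeList 3) mem_edgeList_of_adj
    (crossingList 3) (nestedPolygons ![(2, 0), (-1, 2), (-1, -2)])
    (by decide +kernel) (by decide +kernel) (by decide +kernel) (by decide +kernel)

theorem exists_drawing_four : ∃ D : Drawing (G6_77 □ SimpleGraph.cycleGraph 4),
    D.crossings.Finite ∧ D.crossings.ncard ≤ 8 :=
  exists_drawing_straightLine (vertexList 4) mem_vertexList (edgeList 4) mem_edgeList_of_adj
    (crossingList 4) (nestedPolygons ![(1, 0), (0, 1), (-1, 0), (0, -1)])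
    (by decide +kernel) (by decide +kernel) (by decide +kernel) (by decide +kernel)

theorem exists_drawing_five : ∃ D : Drawing (G6_77 □ SimpleGraph.cycleGraph 5),
    D.crossings.Finite ∧ D.crossings.ncard ≤ 10 :=
  exists_drawing_straightLine (vertexList 5) mem_vertexList (edgeList 5) mem_edgeList_of_adj
    (crossingList 5) (nestedPolygons ![(5, 0), (2, 5), (-4, 3), (-4, -3), (2, -5)])
    (by decide +kernel) (by decide +kernel) (by decide +kernel) (by decide +kernel)

/-! ### The two disjoint copies of `Cₙ □ C₃` in `G6_77 □ Cₙ` -/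

theorem Drawing.arc_mem_Ioo {V : Type*} {G : SimpleGraph V} (D : Drawing G) {e : G.edgeSet}
    {t : ℝ} (ht : t ∈ Set.Icc (0 : ℝ) 1) (h : ∀ w ∈ (e : Sym2 V), D.arc e t ≠ D.vertexMap w) :
    t ∈ Set.Ioo (0 : ℝ) 1 := by
  obtain ⟨u, v, he, hu, hv⟩ := D.arc_endpoints e
  refine ⟨ht.1.lt_of_ne' ?_, ht.2.lt_of_ne ?_⟩
  · rintro rfl
    exact h u (by simp [he]) hu
  · rintro rfl
    exact h v (by simp [he]) hv

theorem Drawing.mem_of_arc_eq {V : Type*} {G : SimpleGraph V} (D : Drawing G) {e : G.edgeSet}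
    {t : ℝ} {w : V} (ht : t ∈ Set.Icc (0 : ℝ) 1) (hw : D.arc e t = D.vertexMap w) :
    w ∈ (e : Sym2 V) := by
  by_contra hn
  refine D.arc_avoids_vertices e t (D.arc_mem_Ioo (e := e) ht fun w' hw' h' => hn ?_) w hw
  rwa [← D.vertexMap_injective (h'.symm.trans hw)]

/-- A point common to the arcs of two edges without common vertex is a crossing. -/
theorem Drawing.mem_crossings_of_arc_eq {V : Type*} {G : SimpleGraph V} (D : Drawing G)
    {e f : G.edgeSet} (hef : ∀ w ∈ (e : Sym2 V), w ∉ (f : Sym2 V)) {s t : ℝ}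
    (hs : s ∈ Set.Icc (0 : ℝ) 1) (ht : t ∈ Set.Icc (0 : ℝ) 1) (h : D.arc e s = D.arc f t) :
    (s(e, f), D.arc e s) ∈ D.crossings := by
  have hs' := D.arc_mem_Ioo hs fun w hw h' => hef w hw (D.mem_of_arc_eq ht (h ▸ h'))
  have ht' := D.arc_mem_Ioo ht fun w hw h' => hef w (D.mem_of_arc_eq hs (h.trans h')) hw
  refine ⟨e, f, ?_, rfl, ⟨s, hs', rfl⟩, ⟨t, ht', h.symm⟩⟩
  rintro rfl
  obtain ⟨u, v, he, -, -⟩ := D.arc_endpoints e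
  exact hef u (by simp [he]) (by simp [he])

section

variable {n : ℕ} {V : Type*} {G : SimpleGraph V} (ι : Fin (n + 3) × Fin 3 → V)
  (hι : ∀ e : TorusEdge (n + 3), G.Adj (ι e.2) (ι e.tgt))

/-- The edge of `G` which corresponds to an edge of `Cₙ □ C₃`. -/
def TorusEdge.toEdge (e : TorusEdge (n + 3)) : G.edgeSet := ⟨s(ι e.2, ι e.tgt), hι e⟩

theorem TorusEdge.toEdge_injective (hinj : Function.Injective ι) :
    Function.Injective (TorusEdge.toEdge ι hι) := by
  have h3 (x : Fin 3) : x + 1 + 1 ≠ x ∧ x + 1 ≠ x := by decide +revert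
  have hn (x : Fin (n + 3)) : x + 1 + 1 ≠ x ∧ x + 1 ≠ x := by
    rw [add_assoc, Ne, add_eq_left, Ne, add_eq_left]
    constructor <;> simp [Fin.ext_iff, Fin.val_add, Nat.mod_eq_of_lt]
  intro e f h
  have h := Sym2.eq_iff.1 (congrArg Subtype.val h)
  simp only [hinj.eq_iff] at h
  obtain ⟨b, i, a⟩ := e
  obtain ⟨b', i', a'⟩ := f
  cases b <;> cases b' <;> simp only [tgt, Prod.ext_iff] at h <;> grind

/-- The restriction of a drawing to a copy of `Cₙ □ C₃`. -/
noncomputable def Drawing.toTorusDrawing (D : Drawing G) : TorusDrawing (n + 3) where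
  point v := Complex.equivRealProdCLM.symm (D.vertexMap (ι v))
  curve e := (fun t => Complex.equivRealProdCLM.symm (D.arc (e.toEdge ι hι) t)) '' Set.Icc 0 1
  joined e := by
    obtain ⟨u, v, he, hu, hv⟩ := D.arc_endpoints (e.toEdge ι hι)
    have h : JoinedIn ((fun t => Complex.equivRealProdCLM.symm (D.arc (e.toEdge ι hι) t)) ''
        Set.Icc 0 1) (Complex.equivRealProdCLM.symm (D.vertexMap u))
        (Complex.equivRealProdCLM.symm (D.vertexMap v)) :=
      .ofLine (Complex.equivRealProdCLM.symm.continuous.comp_continuousOn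
        (D.arc_continuousOn _)) (by simp [hu]) (by simp [hv]) subset_rfl
    rcases Sym2.eq_iff.1 he with ⟨rfl, rfl⟩ | ⟨rfl, rfl⟩
    · exact h
    · exact h.symm

/-- The crossings between edges of a copy of `Cₙ □ C₃`. -/
def Drawing.torusCrossings (D : Drawing G) : Set (Sym2 G.edgeSet × (ℝ × ℝ)) :=
  {x ∈ D.crossings | ∃ e f : TorusEdge (n + 3), x.1 = s(e.toEdge ι hι, f.toEdge ι hι)}

theorem Drawing.le_ncard_torusCrossings (D : Drawing G) (hinj : Function.Injective ι)
    (hD : D.crossings.Finite) : n + 3 ≤ (D.torusCrossings ι hι).ncard := by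
  have hfin : (D.torusCrossings ι hι).Finite := hD.subset (Set.sep_subset _ _)
  have hedge : Function.Injective (TorusEdge.toEdge ι hι) := by
    exact TorusEdge.toEdge_injective ι hι hinj
  have hex (x : D.torusCrossings ι hι) : ∃ p : TorusEdge (n + 3) × TorusEdge (n + 3),
      x.1.1 = s(p.1.toEdge ι hι, p.2.toEdge ι hι) := by
    obtain ⟨x, -, e, f, h⟩ := x
    exact ⟨(e, f), h⟩
  choose P hP using hex
  have := hfin.fintype
  rw [← Nat.card_coe_set_eq, Nat.card_eq_fintype_card, ← Finset.card_univ, ← Finset.length_toList,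
    ← List.length_map (f := P)]
  refine (D.toTorusDrawing ι hι).le_length_of_covers _ fun e f hef hd => ?_
  obtain ⟨_, ⟨s, hs, rfl⟩, ⟨t, ht, h⟩⟩ := Set.not_disjoint_iff.1 hd
  have h' := Complex.equivRealProdCLM.symm.injective h
  have hmem := D.mem_crossings_of_arc_eq (e := e.toEdge ι hι) (f := f.toEdge ι hι) ?_ hs ht h'.symm
  · obtain ⟨x, hx⟩ : ∃ x : D.torusCrossings ι hι, x.1.1 = s(e.toEdge ι hι, f.toEdge ι hι) :=
      ⟨⟨_, hmem, e, f, rfl⟩, rfl⟩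
    rw [hP x] at hx
    have hm (x) : P x ∈ Finset.univ.toList.map P := List.mem_map_of_mem (by simp)
    rcases Sym2.eq_iff.1 hx with ⟨h1, h2⟩ | ⟨h1, h2⟩
    · left
      rw [← hedge h1, ← hedge h2]
      exact hm _
    · right
      rw [← hedge h1, ← hedge h2]
      exact hm _
  · obtain ⟨h1, h2, h3, h4⟩ := hef
    simp only [TorusEdge.toEdge, Sym2.mem_iff]
    rintro w (rfl | rfl) <;> simp only [hinj.eq_iff, not_or] <;> exact ⟨‹_›, ‹_›⟩

end

theorem le_ncard_crossings {n : ℕ} (D : Drawing (G6_77 □ SimpleGraph.cycleGraph (n + 3)))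
    (hD : D.crossings.Finite) : 2 * (n + 3) ≤ D.crossings.ncard := by
  let ι (c : Fin 2) (v : Fin (n + 3) × Fin 3) : Fin 6 × Fin (n + 3) :=
    (finProdFinEquiv (c, v.2), v.1)
  have hι (c : Fin 2) (e : TorusEdge (n + 3)) :
      (G6_77 □ SimpleGraph.cycleGraph (n + 3)).Adj (ι c e.2) (ι c e.tgt) := by
    obtain ⟨b, i, a⟩ := e
    cases b
    · refine SimpleGraph.boxProd_adj.2 (.inl ⟨?_, rfl⟩)
      have : ∀ (c : Fin 2) (a : Fin 3), G6_77.Adj (finProdFinEquiv (c, a))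
        (finProdFinEquiv (c, a + 1)) := by decide
      exact this c a
    · exact SimpleGraph.boxProd_adj.2 (.inr ⟨by simp [SimpleGraph.cycleGraph_adj, ι, tgt], rfl⟩)
  have hinj c : Function.Injective (ι c) := fun v w h => by
    simpa [ι, Prod.ext_iff, and_comm] using h
  have hdisj : Disjoint (D.torusCrossings (ι 0) (hι 0)) (D.torusCrossings (ι 1) (hι 1)) := by
    rw [Set.disjoint_left]
    intro x hx hx'
    obtain ⟨-, e, f, h⟩ := hx
    obtain ⟨-, e', f', h'⟩ := hx'
    have hm : (e.toEdge _ (hι 0)) ∈ s(e'.toEdge _ (hι 1), f'.toEdge _ (hι 1)) := by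
      rw [← h', h]
      exact Sym2.mem_mk_left _ _
    have hne v w : ι 0 v ≠ ι 1 w := fun h => by simp [ι] at h
    have (g : TorusEdge (n + 3)) : e.toEdge _ (hι 0) ≠ g.toEdge _ (hι 1) := fun hg => by
      have := congrArg Subtype.val hg
      simp [TorusEdge.toEdge, hne] at this
    simp [this] at hm
  have h := Set.ncard_union_eq hdisj (hD.subset (Set.sep_subset _ _))
    (hD.subset (Set.sep_subset _ _))
  have h0 := D.le_ncard_torusCrossings _ (hι 0) (hinj 0) hD
  have h1 := D.le_ncard_torusCrossings _ (hι 1) (hinj 1) hD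
  have := Set.ncard_le_ncard (Set.union_subset (Set.sep_subset _ _) (Set.sep_subset _ _) :
    D.torusCrossings (ι 0) (hι 0) ∪ D.torusCrossings (ι 1) (hι 1) ⊆ D.crossings) hD
  omega

theorem crossingNumber_eq {n : ℕ}
    (h : ∃ D : Drawing (G6_77 □ SimpleGraph.cycleGraph (n + 3)),
      D.crossings.Finite ∧ D.crossings.ncard ≤ 2 * (n + 3)) :
    crossingNumber (G6_77 □ SimpleGraph.cycleGraph (n + 3)) = 2 * (n + 3) := by
  obtain ⟨D, hD, hle⟩ := h
  refine le_antisymm (csInf_le_of_le (OrderBot.bddBelow _) ⟨D, hD, rfl⟩ hle) ?_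
  refine le_csInf ⟨_, D, hD, rfl⟩ ?_
  rintro _ ⟨D', hD', rfl⟩
  exact le_ncard_crossings D' hD'

/-- The crossing numbers of `G⁶₇₇ □ C₃`, `G⁶₇₇ □ C₄` and `G⁶₇₇ □ C₅` are
`6`, `8` and `10` respectively. -/
theorem crossingNumber_G6_77_boxProd_smallCycles :
    crossingNumber (G6_77 □ SimpleGraph.cycleGraph 3) = 6 ∧
    crossingNumber (G6_77 □ SimpleGraph.cycleGraph 4) = 8 ∧
    crossingNumber (G6_77 □ SimpleGraph.cycleGraph 5) = 10 :=
  ⟨crossingNumber_eq (n := 0) exists_drawing_three,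
    crossingNumber_eq (n := 1) exists_drawing_four,
    crossingNumber_eq (n := 2) exists_drawing_five⟩
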